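/- For the triple cross product on ℝ⁸, the identity ⟨u×v×w, u×v×w⟩ = |u∧v∧w|² holds, where |u∧v∧w|² is the Gram determinant of u, v, w; in particular u×v×w = 0 if and only if u, v, w are linearly dependent. -/

import Mathlib

noncomputable section

/-- The octonions `𝕆 ≅ ℝ⁸`, realized as pairs of quaternions via Cayley–Dickson. -/
abbrev Octonion : Type := Quaternion ℝ × Quaternion ℝ

/-- Octonion multiplication (Cayley–Dickson doubling of the quaternions). -/
def omul (p q : Octonion) : Octonion :=
  (p.1 * q.1 - star q.2 * p.2, q.2 * p.1 + p.2 * star q.1)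

/-- Octonion conjugation. -/
def oconj (p : Octonion) : Octonion := (star p.1, -p.2)

/-- The standard inner product on the octonions `≅ ℝ⁸`. -/
def oinner (p q : Octonion) : ℝ := (p.1 * star q.1).re + (p.2 * star q.2).re

/-- The triple cross product `u×v×w = ½(u(v̄w) − w(v̄u))`. -/
def tcross (u v w : Octonion) : Octonion :=
  (2 : ℝ)⁻¹ • (omul u (omul (oconj v) w) - omul w (omul (oconj v) u))

/-- The Cayley 4-form `Ψ(u,v,w,z) = ⟨u×v×w, z⟩`. -/
def cayleyΨ (u v w z : Octonion) : ℝ := oinner (tcross u v w) z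

theorem oinner_eq (p q : Octonion) : oinner p q =
    p.1.re * q.1.re + p.1.imI * q.1.imI + p.1.imJ * q.1.imJ + p.1.imK * q.1.imK +
    (p.2.re * q.2.re + p.2.imI * q.2.imI + p.2.imJ * q.2.imJ + p.2.imK * q.2.imK) := by
  simp [oinner]

theorem oinner_comm (p q : Octonion) : oinner p q = oinner q p := by
  simp only [oinner_eq]; ring

theorem oinner_sub_left (p q r : Octonion) :
    oinner (p - q) r = oinner p r - oinner q r := by
  simp [oinner_eq]; ring

theorem oinner_smul_left (c : ℝ) (p q : Octonion) : oinner (c • p) q = c * oinner p q := by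
  simp [oinner_eq]; ring

theorem oinner_sub_right (p q r : Octonion) :
    oinner p (q - r) = oinner p q - oinner p r := by
  simp only [oinner_comm p, oinner_sub_left]

theorem oinner_smul_right (c : ℝ) (p q : Octonion) : oinner p (c • q) = c * oinner p q := by
  simp only [oinner_comm p, oinner_smul_left]

theorem oinner_oconj_self (p : Octonion) : oinner (oconj p) (oconj p) = oinner p p := by
  simp [oinner_eq, oconj]

theorem oinner_omul_omul (p q r : Octonion) :
    oinner (omul p q) (omul p r) = oinner p p * oinner q r := by
  simp [oinner_eq, omul]; ring

theorem omul_omul_oconj (u v w : Octonion) :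
    omul u (omul (oconj v) w) = (2 * oinner u v) • w - omul v (omul (oconj u) w) := by
  ext <;> simp only [omul, oconj, oinner_eq, Prod.fst_sub, Prod.snd_sub, Prod.smul_fst,
    Prod.smul_snd, Quaternion.re_sub, Quaternion.imI_sub, Quaternion.imJ_sub, Quaternion.imK_sub,
    Quaternion.re_add, Quaternion.imI_add, Quaternion.imJ_add, Quaternion.imK_add,
    Quaternion.re_mul, Quaternion.imI_mul, Quaternion.imJ_mul, Quaternion.imK_mul,
    Quaternion.re_neg, Quaternion.imI_neg, Quaternion.imJ_neg, Quaternion.imK_neg,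
    Quaternion.re_star, Quaternion.imI_star, Quaternion.imJ_star, Quaternion.imK_star,
    Quaternion.re_smul, Quaternion.imI_smul, Quaternion.imJ_smul, Quaternion.imK_smul,
    smul_eq_mul] <;> ring

theorem oinner_omul_oconj_omul (u v w : Octonion) :
    oinner w (omul v (omul (oconj w) u)) =
      2 * oinner v w * oinner u w - oinner w w * oinner u v := by
  simp [oinner_eq, omul, oconj]; ring

theorem oinner_oconj_omul_swap (u w : Octonion) :
    oinner (omul (oconj u) w) (omul (oconj w) u) =
      2 * oinner u w ^ 2 - oinner u u * oinner w w := by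
  simp [oinner_eq, omul, oconj]; ring

theorem oinner_omul_omul_oconj (u v w : Octonion) :
    oinner (omul u (omul (oconj v) w)) (omul w (omul (oconj v) u)) =
      4 * oinner u v * oinner v w * oinner u w
        - 2 * oinner u v * oinner w (omul v (omul (oconj w) u))
        - 2 * oinner v w * oinner u (omul v (omul (oconj u) w))
        + oinner v v * (2 * oinner u w ^ 2 - oinner u u * oinner w w) := by
  rw [omul_omul_oconj u v w, omul_omul_oconj w v u, ← oinner_oconj_omul_swap u w,
    ← oinner_omul_omul]
  simp only [oinner_sub_left, oinner_sub_right, oinner_smul_left, oinner_smul_right,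
    oinner_comm w v, oinner_comm w u, oinner_comm (omul v (omul (oconj u) w)) u]
  ring

theorem oinner_omul_omul_oconj_self (u v w : Octonion) :
    oinner (omul u (omul (oconj v) w)) (omul u (omul (oconj v) w)) =
      oinner u u * (oinner v v * oinner w w) := by
  rw [oinner_omul_omul, oinner_omul_omul, oinner_oconj_self]

theorem oinner_tcross_self (u v w : Octonion) :
    oinner (tcross u v w) (tcross u v w) =
      Matrix.det (Matrix.of fun i j : Fin 3 =>
        oinner (![u, v, w] i) (![u, v, w] j)) := by
  simp only [tcross, oinner_smul_left, oinner_smul_right, oinner_sub_left, oinner_sub_right,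
    oinner_omul_omul_oconj_self, oinner_comm (omul w _) (omul u _), oinner_omul_omul_oconj,
    oinner_omul_oconj_omul, Matrix.det_fin_three, Matrix.of_apply, Matrix.cons_val,
    oinner_comm v u, oinner_comm w u, oinner_comm w v]
  ring

theorem oinner_self_eq_zero {p : Octonion} : oinner p p = 0 ↔ p = 0 := by
  have h := inner_self_eq_zero (𝕜 := ℝ) (x := WithLp.toLp 2 p)
  rw [WithLp.prod_inner_apply, WithLp.toLp_eq_zero] at h
  exact h

theorem linearIndependent_iff_det_oinner_ne_zero {n : Type*} [Fintype n] [DecidableEq n]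
    {x : n → Octonion} :
    LinearIndependent ℝ x ↔ (Matrix.of fun i j => oinner (x i) (x j)).det ≠ 0 := by
  have h : (Matrix.of fun i j => oinner (x i) (x j)) =
      Matrix.gram ℝ ((WithLp.linearEquiv 2 ℝ Octonion).symm ∘ x) := by
    ext i j
    simp only [Matrix.gram_apply, WithLp.prod_inner_apply]
    rfl
  rw [h, Matrix.det_gram_ne_zero_iff_linearIndependent]
  exact (LinearMap.linearIndependent_iff _ (LinearEquiv.ker _)).symm

/-- `⟨u×v×w, u×v×w⟩ = |u∧v∧w|²` (the Gram determinant of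
`u, v, w`); in particular `u×v×w = 0` iff `u, v, w` are linearly dependent. -/
theorem tcross_norm_sq_eq_gram (u v w : Octonion) :
    oinner (tcross u v w) (tcross u v w) =
      Matrix.det (Matrix.of fun i j : Fin 3 =>
        oinner (![u, v, w] i) (![u, v, w] j)) ∧
    (tcross u v w = 0 ↔ ¬ LinearIndependent ℝ ![u, v, w]) := by
  refine ⟨oinner_tcross_self u v w, ?_⟩
  rw [linearIndependent_iff_det_oinner_ne_zero, not_not, ← oinner_tcross_self,
    oinner_self_eq_zero]
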